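/- arXiv:2311.00220 — 4 statements merged into one kernel-verified Lean document; each statement's English description precedes it below -/
import Mathlib

section
/- Let R be a commutative Noetherian local ring and let L, M, N be finitely generated R-modules. Suppose the pair (M,N) is covariantly reflexive with respect to L. Then every additive map φ : tr_{L,N}(M) → Hom_R(L,N) satisfying φ(h ∘ e) = φ(h) ∘ e for all h ∈ tr_{L,N}(M) and all e ∈ End_R(L) has image contained in tr_{L,N}(M). Consequently, composition with the inclusion tr_{L,N}(M) ↪ Hom_R(L,N) gives a bijection from the set of right End_R(L)-equivariant additive maps tr_{L,N}(M) → tr_{L,N}(M) to the set of right End_R(L)-equivariant additive maps tr_{L,N}(M) → Hom_R(L,N). -/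
/-- The trace submodule `tr_{L,N}(M)`: the `R`-submodule of `Hom_R(L,N)` generated by all
compositions `f ∘ g` with `g ∈ Hom_R(L,M)` and `f ∈ Hom_R(M,N)`. -/
def traceSub (R L M N : Type*) [CommRing R] [AddCommGroup L] [Module R L]
    [AddCommGroup M] [Module R M] [AddCommGroup N] [Module R N] : Submodule R (L →ₗ[R] N) :=
  Submodule.span R {h : L →ₗ[R] N | ∃ (f : M →ₗ[R] N) (g : L →ₗ[R] M), h = f ∘ₗ g}

/-- The trace submodule is closed under precomposition by endomorphisms of `L`. -/
lemma traceSub_comp_mem {R L M N : Type*} [CommRing R] [AddCommGroup L] [Module R L]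
    [AddCommGroup M] [Module R M] [AddCommGroup N] [Module R N]
    {h : L →ₗ[R] N} (hh : h ∈ traceSub R L M N) (e : Module.End R L) :
    h ∘ₗ e ∈ traceSub R L M N := by
  have h2 : (LinearMap.lcomp R N e) h ∈ (traceSub R L M N).map (LinearMap.lcomp R N e) :=
    Submodule.mem_map_of_mem hh
  rw [traceSub, Submodule.map_span] at h2
  refine Submodule.span_le.mpr ?_ h2
  rintro x ⟨y, ⟨f, g, rfl⟩, rfl⟩
  exact Submodule.subset_span ⟨f, g ∘ₗ e, rfl⟩

/-- An additive map on the trace submodule that commutes with precomposition by endomorphisms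
of `L` is homogeneous. -/
lemma traceSub_map_smul {R L M N : Type*} [CommRing R] [AddCommGroup L] [Module R L]
    [AddCommGroup M] [Module R M] [AddCommGroup N] [Module R N]
    {φ : ↥(traceSub R L M N) →+ (L →ₗ[R] N)}
    (hφ : ∀ (h : ↥(traceSub R L M N)) (e : Module.End R L),
      φ ⟨(h : L →ₗ[R] N) ∘ₗ e, traceSub_comp_mem h.2 e⟩ = φ h ∘ₗ e)
    (r : R) (h : ↥(traceSub R L M N)) : φ (r • h) = r • φ h := by
  have hr := hφ h (r • LinearMap.id)
  simp only [LinearMap.comp_smul, LinearMap.comp_id] at hr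
  exact hr

/-- If every equivariant additive map `Hom_R(L,M) → Hom_R(L,N)` is postcomposition with some
`M → N`, then every equivariant additive map `tr_{L,N}(M) → Hom_R(L,N)` takes values in
`tr_{L,N}(M)`. -/
lemma traceSub_map_mem {R L M N : Type*} [CommRing R] [AddCommGroup L] [Module R L]
    [AddCommGroup M] [Module R M] [AddCommGroup N] [Module R N]
    (hsurj : ∀ w : (L →ₗ[R] M) →+ (L →ₗ[R] N),
      (∀ (g : L →ₗ[R] M) (e : Module.End R L), w (g ∘ₗ e) = w g ∘ₗ e) →
      ∃ f : M →ₗ[R] N, ∀ g : L →ₗ[R] M, w g = f ∘ₗ g)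
    {φ : ↥(traceSub R L M N) →+ (L →ₗ[R] N)}
    (hφ : ∀ (h : ↥(traceSub R L M N)) (e : Module.End R L),
      φ ⟨(h : L →ₗ[R] N) ∘ₗ e, traceSub_comp_mem h.2 e⟩ = φ h ∘ₗ e)
    (h : ↥(traceSub R L M N)) : φ h ∈ traceSub R L M N := by
  obtain ⟨h, hh⟩ := h
  induction hh using Submodule.span_induction with
  | mem x hx =>
    obtain ⟨f, g, rfl⟩ := hx
    let post : (L →ₗ[R] M) →+ ↥(traceSub R L M N) :=
      { toFun := fun g => ⟨f ∘ₗ g, Submodule.subset_span ⟨f, g, rfl⟩⟩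
        map_zero' := Subtype.ext (LinearMap.comp_zero f)
        map_add' := fun g₁ g₂ => Subtype.ext (LinearMap.comp_add g₁ g₂ f) }
    obtain ⟨f', hf'⟩ := hsurj (φ.comp post) fun g e => hφ (post g) e
    exact Submodule.subset_span ⟨f', g, hf' g⟩
  | zero => exact (map_zero φ).symm ▸ Submodule.zero_mem _
  | add x y hx hy ihx ihy => exact (map_add φ ⟨x, hx⟩ ⟨y, hy⟩).symm ▸ Submodule.add_mem _ ihx ihy
  | smul r x hx ih => exact (traceSub_map_smul hφ r ⟨x, hx⟩).symm ▸ Submodule.smul_mem _ r ih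

/-- Suppose the pair `(M,N)` is covariantly reflexive with respect to `L` (the map
`f ↦ (g ↦ f ∘ g)` is a bijection from `Hom_R(M,N)` onto the right-`End_R(L)`-equivariant
additive maps `Hom_R(L,M) → Hom_R(L,N)`; stated here as unique existence of a preimage for
each such equivariant map).  Then:
(1) every right-`End_R(L)`-equivariant additive map `φ : tr_{L,N}(M) → Hom_R(L,N)` has image
contained in `tr_{L,N}(M)`; and
(2) composition with the inclusion `tr_{L,N}(M) ↪ Hom_R(L,N)` is a bijection from the
right-`End_R(L)`-equivariant additive endomaps of `tr_{L,N}(M)` to the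
right-`End_R(L)`-equivariant additive maps `tr_{L,N}(M) → Hom_R(L,N)` (stated as: each such
map lifts uniquely through the inclusion to an equivariant endomap). -/
theorem traceSub_covariantly_reflexive_lifting
    (R : Type*) [CommRing R] [IsNoetherianRing R] [IsLocalRing R]
    (L M N : Type*)
    [AddCommGroup L] [Module R L] [Module.Finite R L]
    [AddCommGroup M] [Module R M] [Module.Finite R M]
    [AddCommGroup N] [Module R N] [Module.Finite R N]
    (hrefl : ∀ w : (L →ₗ[R] M) →+ (L →ₗ[R] N),
      (∀ (g : L →ₗ[R] M) (e : Module.End R L), w (g ∘ₗ e) = w g ∘ₗ e) →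
      ∃! f : M →ₗ[R] N, ∀ g : L →ₗ[R] M, w g = f ∘ₗ g) :
    (∀ φ : ↥(traceSub R L M N) →+ (L →ₗ[R] N),
      (∀ (h : ↥(traceSub R L M N)) (e : Module.End R L),
        φ ⟨(h : L →ₗ[R] N) ∘ₗ e, traceSub_comp_mem h.2 e⟩ = φ h ∘ₗ e) →
      ∀ h : ↥(traceSub R L M N), φ h ∈ traceSub R L M N)
    ∧
    (∀ ψ : ↥(traceSub R L M N) →+ (L →ₗ[R] N),
      (∀ (h : ↥(traceSub R L M N)) (e : Module.End R L),
        ψ ⟨(h : L →ₗ[R] N) ∘ₗ e, traceSub_comp_mem h.2 e⟩ = ψ h ∘ₗ e) →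
      ∃! φ : ↥(traceSub R L M N) →+ ↥(traceSub R L M N),
        (∀ (h : ↥(traceSub R L M N)) (e : Module.End R L),
          ((φ ⟨(h : L →ₗ[R] N) ∘ₗ e, traceSub_comp_mem h.2 e⟩ : ↥(traceSub R L M N)) : L →ₗ[R] N)
            = ((φ h : ↥(traceSub R L M N)) : L →ₗ[R] N) ∘ₗ e)
        ∧ ∀ h : ↥(traceSub R L M N), ((φ h : ↥(traceSub R L M N)) : L →ₗ[R] N) = ψ h) := by
  have hmem {φ : ↥(traceSub R L M N) →+ (L →ₗ[R] N)}
      (hφ : ∀ (h : ↥(traceSub R L M N)) (e : Module.End R L),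
        φ ⟨(h : L →ₗ[R] N) ∘ₗ e, traceSub_comp_mem h.2 e⟩ = φ h ∘ₗ e)
      (h : ↥(traceSub R L M N)) : φ h ∈ traceSub R L M N :=
    traceSub_map_mem (fun w hw => (hrefl w hw).exists) hφ h
  refine ⟨fun φ hφ => hmem hφ, fun ψ hψ => ?_⟩
  refine ⟨ψ.codRestrict (traceSub R L M N) (hmem hψ), ⟨hψ, fun _ => rfl⟩, ?_⟩
  rintro φ ⟨-, hφ⟩
  exact AddMonoidHom.ext fun h => Subtype.ext (hφ h)
end

section
/- Let R be a commutative Noetherian local ring and let L, M, N be finitely generated R-modules. Suppose the pair (L,M) is contravariantly reflexive with respect to N. Then every additive map φ : tr_{L,N}(M) → Hom_R(L,N) satisfying φ(e ∘ h) = e ∘ φ(h) for all h ∈ tr_{L,N}(M) and all e ∈ End_R(N) has image contained in tr_{L,N}(M). Consequently, composition with the inclusion tr_{L,N}(M) ↪ Hom_R(L,N) gives a bijection from the set of left End_R(N)-equivariant additive maps tr_{L,N}(M) → tr_{L,N}(M) to the set of left End_R(N)-equivariant additive maps tr_{L,N}(M) → Hom_R(L,N). -/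
/-- The trace submodule is closed under postcomposition by endomorphisms of `N`. -/
lemma traceSub_postcomp_mem {R L M N : Type*} [CommRing R] [AddCommGroup L] [Module R L]
    [AddCommGroup M] [Module R M] [AddCommGroup N] [Module R N]
    {h : L →ₗ[R] N} (hh : h ∈ traceSub R L M N) (e : Module.End R N) :
    e ∘ₗ h ∈ traceSub R L M N := by
  have h2 : (LinearMap.llcomp R L N N e) h ∈ (traceSub R L M N).map (LinearMap.llcomp R L N N e) :=
    Submodule.mem_map_of_mem hh
  rw [traceSub, Submodule.map_span] at h2
  refine Submodule.span_le.mpr ?_ h2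
  rintro x ⟨y, ⟨f, g, rfl⟩, rfl⟩
  exact Submodule.subset_span ⟨e ∘ₗ f, g, rfl⟩

/-- An equivariant additive map out of the trace submodule takes values in the trace submodule,
provided every equivariant additive map `Hom_R(M,N) → Hom_R(L,N)` is precomposition with some
map `L → M`. -/
lemma traceSub_equivariant_apply_mem {R L M N : Type*} [CommRing R]
    [AddCommGroup L] [Module R L] [AddCommGroup M] [Module R M] [AddCommGroup N] [Module R N]
    (hsurj : ∀ u : (M →ₗ[R] N) →+ (L →ₗ[R] N),
      (∀ (f : M →ₗ[R] N) (e : Module.End R N), u (e ∘ₗ f) = e ∘ₗ u f) →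
      ∃ g : L →ₗ[R] M, ∀ f : M →ₗ[R] N, u f = f ∘ₗ g)
    (φ : ↥(traceSub R L M N) →+ (L →ₗ[R] N))
    (hφ : ∀ (h : ↥(traceSub R L M N)) (e : Module.End R N),
      φ ⟨e ∘ₗ (h : L →ₗ[R] N), traceSub_postcomp_mem h.2 e⟩ = e ∘ₗ φ h)
    (h : ↥(traceSub R L M N)) : φ h ∈ traceSub R L M N := by
  obtain ⟨h, hh⟩ := h
  have hgen (f : M →ₗ[R] N) (g : L →ₗ[R] M) : f ∘ₗ g ∈ traceSub R L M N :=
    Submodule.subset_span ⟨f, g, rfl⟩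
  induction hh using Submodule.span_induction with
  | mem x hx =>
    obtain ⟨f, g, rfl⟩ := hx
    let u : (M →ₗ[R] N) →+ (L →ₗ[R] N) := AddMonoidHom.mk'
      (fun f => φ ⟨f ∘ₗ g, hgen f g⟩) fun a b => by
        rw [← map_add]
        rfl
    obtain ⟨g', hg'⟩ := hsurj u fun f e => hφ ⟨f ∘ₗ g, hgen f g⟩ e
    have key : φ ⟨f ∘ₗ g, hgen f g⟩ = f ∘ₗ g' := hg' f
    rw [key]
    exact hgen f g'
  | zero =>
    have key : φ ⟨0, zero_mem _⟩ = 0 := map_zero φ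
    rw [key]
    exact zero_mem _
  | add x y hx hy ihx ihy =>
    have key : φ ⟨x + y, add_mem hx hy⟩ = φ ⟨x, hx⟩ + φ ⟨y, hy⟩ := map_add φ ⟨x, hx⟩ ⟨y, hy⟩
    rw [key]
    exact add_mem ihx ihy
  | smul r x hx ih =>
    have key : φ ⟨r • x, Submodule.smul_mem _ r hx⟩ = r • φ ⟨x, hx⟩ :=
      hφ ⟨x, hx⟩ (r • LinearMap.id)
    rw [key]
    exact Submodule.smul_mem _ r ih

/-- Suppose the pair `(L,M)` is contravariantly reflexive with respect to `N` (the map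
`g ↦ (f ↦ f ∘ g)` is a bijection from `Hom_R(L,M)` onto the left-`End_R(N)`-equivariant
additive maps `Hom_R(M,N) → Hom_R(L,N)`; stated here as unique existence of a preimage for
each such equivariant map).  Then:
(1) every left-`End_R(N)`-equivariant additive map `φ : tr_{L,N}(M) → Hom_R(L,N)` has image
contained in `tr_{L,N}(M)`; and
(2) composition with the inclusion `tr_{L,N}(M) ↪ Hom_R(L,N)` is a bijection from the
left-`End_R(N)`-equivariant additive endomaps of `tr_{L,N}(M)` to the
left-`End_R(N)`-equivariant additive maps `tr_{L,N}(M) → Hom_R(L,N)` (stated as: each such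
map lifts uniquely through the inclusion to an equivariant endomap). -/
theorem traceSub_contravariantly_reflexive_lifting
    (R : Type*) [CommRing R] [IsNoetherianRing R] [IsLocalRing R]
    (L M N : Type*)
    [AddCommGroup L] [Module R L] [Module.Finite R L]
    [AddCommGroup M] [Module R M] [Module.Finite R M]
    [AddCommGroup N] [Module R N] [Module.Finite R N]
    (hrefl : ∀ u : (M →ₗ[R] N) →+ (L →ₗ[R] N),
      (∀ (f : M →ₗ[R] N) (e : Module.End R N), u (e ∘ₗ f) = e ∘ₗ u f) →
      ∃! g : L →ₗ[R] M, ∀ f : M →ₗ[R] N, u f = f ∘ₗ g) :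
    (∀ φ : ↥(traceSub R L M N) →+ (L →ₗ[R] N),
      (∀ (h : ↥(traceSub R L M N)) (e : Module.End R N),
        φ ⟨e ∘ₗ (h : L →ₗ[R] N), traceSub_postcomp_mem h.2 e⟩ = e ∘ₗ φ h) →
      ∀ h : ↥(traceSub R L M N), φ h ∈ traceSub R L M N)
    ∧
    (∀ ψ : ↥(traceSub R L M N) →+ (L →ₗ[R] N),
      (∀ (h : ↥(traceSub R L M N)) (e : Module.End R N),
        ψ ⟨e ∘ₗ (h : L →ₗ[R] N), traceSub_postcomp_mem h.2 e⟩ = e ∘ₗ ψ h) →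
      ∃! φ : ↥(traceSub R L M N) →+ ↥(traceSub R L M N),
        (∀ (h : ↥(traceSub R L M N)) (e : Module.End R N),
          ((φ ⟨e ∘ₗ (h : L →ₗ[R] N), traceSub_postcomp_mem h.2 e⟩ : ↥(traceSub R L M N)) : L →ₗ[R] N)
            = e ∘ₗ ((φ h : ↥(traceSub R L M N)) : L →ₗ[R] N))
        ∧ ∀ h : ↥(traceSub R L M N), ((φ h : ↥(traceSub R L M N)) : L →ₗ[R] N) = ψ h) := by
  have hmem := traceSub_equivariant_apply_mem fun u hu => (hrefl u hu).exists
  refine ⟨hmem, fun ψ hψ => ?_⟩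
  refine ⟨AddMonoidHom.mk' (fun h => ⟨ψ h, hmem ψ hψ h⟩) fun a b => Subtype.ext (map_add ψ a b),
    ⟨hψ, fun _ => rfl⟩, fun φ hφ => ?_⟩
  ext1 h
  exact Subtype.ext (hφ.2 h)
end

section
/- Let R be a commutative Noetherian local ring and let M be a finitely generated torsionless R-module (i.e., there exist n ∈ ℕ and an injective R-linear map M → R^{⊕n}). Then M is faithful (its annihilator is the zero ideal) if and only if for every associated prime 𝔭 of R there exists n_𝔭 ∈ ℕ such that R_𝔭 is isomorphic to a direct summand of M_𝔭^{⊕n_𝔭} as an R_𝔭-module. -/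
/-- `X ∈ Add_R(M)`: `X` is isomorphic to a direct summand of `M^{⊕n}` for some `n`,
equivalently there is a split injection `X → M^{⊕n}`. -/
def MemAdd (R X M : Type*) [CommRing R] [AddCommGroup X] [Module R X]
    [AddCommGroup M] [Module R M] : Prop :=
  ∃ (n : ℕ) (i : X →ₗ[R] (Fin n → M)) (p : (Fin n → M) →ₗ[R] X), p ∘ₗ i = LinearMap.id

/-- A ring `R` belongs to `Add_R(M)` as soon as some linear form on `M` takes a unit value. -/
theorem memAdd_self_of_isUnit_apply {R M : Type*} [CommRing R] [AddCommGroup M] [Module R M]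
    (f : M →ₗ[R] R) (m : M) (h : IsUnit (f m)) : MemAdd R R M := by
  obtain ⟨u, hu⟩ := h
  refine ⟨1, LinearMap.pi fun _ ↦ LinearMap.toSpanSingleton R M ((↑u⁻¹ : R) • m),
    f ∘ₗ LinearMap.proj 0, ?_⟩
  ext
  simp [← hu]

/-- A scalar that kills `M` is zero if `R ∈ Add_R(M)`. -/
theorem MemAdd.eq_zero_of_smul_eq_zero {R M : Type*} [CommRing R] [AddCommGroup M] [Module R M]
    (h : MemAdd R R M) {r : R} (hr : ∀ m : M, r • m = 0) : r = 0 := by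
  obtain ⟨n, i, p, hpi⟩ := h
  have hi : i r = 0 := by
    rw [← mul_one r, ← smul_eq_mul, map_smul]
    exact funext fun j ↦ hr _
  simpa [hi] using (LinearMap.congr_fun hpi r).symm

/-- For a faithful torsionless module `M`, the trace ideal of `M` is contained in no associated
prime of `R`. -/
theorem exists_dual_apply_notMem {R M : Type*} [CommRing R] [IsNoetherianRing R]
    [AddCommGroup M] [Module R M]
    (hM : ∃ (n : ℕ) (i : M →ₗ[R] (Fin n → R)), Function.Injective i)
    (hfaithful : Module.annihilator R M = ⊥) {𝔭 : Ideal R} (h𝔭 : 𝔭 ∈ associatedPrimes R R) :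
    ∃ (f : M →ₗ[R] R) (m : M), f m ∉ 𝔭 := by
  obtain ⟨n, i, hi⟩ := hM
  obtain ⟨hprime, x, rfl⟩ := isAssociatedPrime_iff.1 h𝔭
  by_contra! hmem
  have hx0 : x ∈ Module.annihilator R M := Module.mem_annihilator.2 fun m ↦ by
    refine hi (funext fun j ↦ ?_)
    simpa [mul_comm] using Submodule.mem_colon_singleton.1 (hmem (LinearMap.proj j ∘ₗ i) m)
  rw [hfaithful, Ideal.mem_bot] at hx0
  exact hprime.ne_top (by simp [hx0])

/-- An element of a Noetherian ring vanishing in the localizations at all associated primes is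
zero. -/
theorem eq_zero_of_localization_associatedPrimes {R : Type*} [CommRing R] [IsNoetherianRing R]
    {r : R} (h : ∀ 𝔭 : PrimeSpectrum R, 𝔭.asIdeal ∈ associatedPrimes R R →
      algebraMap R (Localization.AtPrime 𝔭.asIdeal) r = 0) : r = 0 := by
  by_contra hr
  obtain ⟨𝔭, h𝔭, hle⟩ := exists_le_isAssociatedPrime_of_isNoetherianRing R r hr
  have := h𝔭.1
  obtain ⟨t, ht⟩ := (IsLocalization.map_eq_zero_iff 𝔭.primeCompl _ r).1 (h ⟨𝔭, h𝔭.1⟩ h𝔭)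
  exact t.2 (hle (by simpa using ht))

/-- Let `M` be a finitely generated torsionless module over a commutative Noetherian local
ring `R`.  Then `M` is faithful iff for every associated prime `𝔭` of `R`, `R_𝔭` is (isomorphic
to) a direct summand of some `M_𝔭^{⊕n}`. -/
theorem faithful_iff_localization_summand
    (R : Type*) [CommRing R] [IsNoetherianRing R] [IsLocalRing R]
    (M : Type*) [AddCommGroup M] [Module R M] [Module.Finite R M]
    (htorsionless : ∃ (n : ℕ) (i : M →ₗ[R] (Fin n → R)), Function.Injective i) :
    Module.annihilator R M = ⊥ ↔
      ∀ 𝔭 : PrimeSpectrum R, 𝔭.asIdeal ∈ associatedPrimes R R →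
        MemAdd (Localization.AtPrime 𝔭.asIdeal) (Localization.AtPrime 𝔭.asIdeal)
          (LocalizedModule 𝔭.asIdeal.primeCompl M) := by
  constructor
  · intro hM 𝔭 h𝔭
    obtain ⟨f, m, hfm⟩ := exists_dual_apply_notMem htorsionless hM h𝔭
    exact memAdd_self_of_isUnit_apply
      (IsLocalizedModule.mapExtendScalars 𝔭.asIdeal.primeCompl
        (LocalizedModule.mkLinearMap 𝔭.asIdeal.primeCompl M)
        (Algebra.linearMap R (Localization.AtPrime 𝔭.asIdeal))
        (Localization.AtPrime 𝔭.asIdeal) f)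
      (LocalizedModule.mkLinearMap 𝔭.asIdeal.primeCompl M m)
      (by
        rw [IsLocalizedModule.mapExtendScalars_apply_apply, IsLocalizedModule.map_apply]
        exact IsLocalization.map_units (M := 𝔭.asIdeal.primeCompl) _ ⟨f m, hfm⟩)
  · intro h
    refine (Submodule.eq_bot_iff _).2 fun r hr ↦
      eq_zero_of_localization_associatedPrimes fun 𝔭 h𝔭 ↦ ?_
    refine (h 𝔭 h𝔭).eq_zero_of_smul_eq_zero fun y ↦ ?_
    induction y using LocalizedModule.induction_on with
    | _ m s =>
      rw [algebraMap_smul, LocalizedModule.smul'_mk, Module.mem_annihilator.1 hr m,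
        LocalizedModule.zero_mk]
end

section
/- Let R be a commutative Noetherian local ring and let M be a finitely generated R-module that is faithful (Ann_R(M) = 0) and reflexive (the natural evaluation map M → Hom_R(Hom_R(M,R),R) is an isomorphism). Then there is an isomorphism of rings between End_R(tr_R(M)) and the center Z(End_R(M)) of the endomorphism ring of M. -/
/-- The trace ideal `tr_R(M)`: the ideal of `R` generated by all elements `f(x)` with
`f ∈ Hom_R(M,R)` and `x ∈ M`. -/
def traceIdeal (R M : Type*) [CommRing R] [AddCommGroup M] [Module R M] : Ideal R :=
  Submodule.span R {r : R | ∃ (f : M →ₗ[R] R) (x : M), r = f x}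

section TraceIdeal

variable {R M : Type*} [CommRing R] [AddCommGroup M] [Module R M]

theorem apply_mem_traceIdeal (f : M →ₗ[R] R) (x : M) : f x ∈ traceIdeal R M :=
  Submodule.subset_span ⟨f, x, rfl⟩

/-- Endomorphisms of the trace ideal act on the dual module by postcomposition. -/
def traceIdealDualAction (σ : Module.End R (traceIdeal R M)) :
    Module.Dual R M →ₗ[R] Module.Dual R M where
  toFun f := (traceIdeal R M).subtype ∘ₗ σ ∘ₗ f.codRestrict _ (apply_mem_traceIdeal f)
  map_add' f g := by
    ext x
    exact congrArg Subtype.val (map_add σ ⟨f x, apply_mem_traceIdeal f x⟩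
      ⟨g x, apply_mem_traceIdeal g x⟩)
  map_smul' r f := by
    ext x
    exact congrArg Subtype.val (map_smul σ r ⟨f x, apply_mem_traceIdeal f x⟩)

/-- Two endomorphisms of the trace ideal agree if they agree on the values of functionals. -/
theorem traceIdeal_end_ext {σ τ : Module.End R (traceIdeal R M)}
    (h : ∀ (f : M →ₗ[R] R) (x : M),
      σ ⟨f x, apply_mem_traceIdeal f x⟩ = τ ⟨f x, apply_mem_traceIdeal f x⟩) : σ = τ := by
  ext ⟨a, ha⟩ : 1
  refine Submodule.span_induction (p := fun a ha => σ ⟨a, ha⟩ = τ ⟨a, ha⟩) ?_ ?_ ?_ ?_ ha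
  · rintro _ ⟨f, x, rfl⟩
    exact h f x
  · exact (map_zero σ).trans (map_zero τ).symm
  · intro a b ha hb h₁ h₂
    exact (map_add σ ⟨a, ha⟩ ⟨b, hb⟩).trans
      ((congrArg₂ (· + ·) h₁ h₂).trans (map_add τ ⟨a, ha⟩ ⟨b, hb⟩).symm)
  · intro r a ha h₁
    exact (map_smul σ r ⟨a, ha⟩).trans
      ((congrArg (r • ·) h₁).trans (map_smul τ r ⟨a, ha⟩).symm)

/-- Over a reflexive module, every endomorphism of the trace ideal is induced by an
endomorphism of the module. -/
theorem exists_end_of_traceIdeal_end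
    (hM : Function.Bijective (Module.Dual.eval R M)) (σ : Module.End R (traceIdeal R M)) :
    ∃ g : Module.End R M, ∀ (f : M →ₗ[R] R) (x : M),
      f (g x) = σ ⟨f x, apply_mem_traceIdeal f x⟩ := by
  let e := LinearEquiv.ofBijective _ hM
  refine ⟨e.symm.toLinearMap ∘ₗ (traceIdealDualAction σ).dualMap ∘ₗ e.toLinearMap,
    fun f x => ?_⟩
  exact LinearMap.congr_fun
    (e.apply_symm_apply ((traceIdealDualAction σ).dualMap (e x))) f

/-- Functionals separate the endomorphisms of a torsionless module. -/
theorem end_ext_of_eval_injective (hM : Function.Injective (Module.Dual.eval R M))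
    {g h : Module.End R M} (H : ∀ (f : M →ₗ[R] R) (x : M), f (g x) = f (h x)) : g = h :=
  LinearMap.ext fun x => hM (LinearMap.ext fun f => H f x)

/-- A central endomorphism multiplied by an element of the trace ideal is a homothety by an
element of the trace ideal. -/
theorem exists_smul_eq_of_mem_center {c : Module.End R M}
    (hc : c ∈ Subring.center (Module.End R M)) {a : R} (ha : a ∈ traceIdeal R M) :
    ∃ b : traceIdeal R M, ∀ y : M, a • c y = (b : R) • y := by
  induction ha using Submodule.span_induction with
  | mem a h =>
    obtain ⟨f, x, rfl⟩ := h
    refine ⟨⟨f (c x), apply_mem_traceIdeal f (c x)⟩, fun y => ?_⟩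
    have h := LinearMap.congr_fun (Subring.mem_center_iff.1 hc (f.smulRight y)) x
    simpa using h.symm
  | zero => exact ⟨0, by simp⟩
  | add a b _ _ h₁ h₂ =>
    obtain ⟨a', h₁⟩ := h₁
    obtain ⟨b', h₂⟩ := h₂
    exact ⟨a' + b', fun y => by simp [add_smul, h₁, h₂]⟩
  | smul r a _ h =>
    obtain ⟨a', h⟩ := h
    exact ⟨r • a', fun y => by simp [mul_smul, h]⟩

/-- Over a faithful module, every central endomorphism induces an endomorphism of the
trace ideal. -/
theorem exists_traceIdeal_end_of_mem_center (hM : Module.annihilator R M = ⊥)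
    {c : Module.End R M} (hc : c ∈ Subring.center (Module.End R M)) :
    ∃ σ : Module.End R (traceIdeal R M), ∀ (f : M →ₗ[R] R) (x : M),
      f (c x) = σ ⟨f x, apply_mem_traceIdeal f x⟩ := by
  have eq_of_smul {r s : R} (h : ∀ y : M, r • y = s • y) : r = s := by
    have : r - s ∈ Module.annihilator R M :=
      Module.mem_annihilator.2 fun y => by rw [sub_smul, h, sub_self]
    rwa [hM, Ideal.mem_bot, sub_eq_zero] at this
  choose b hb using fun a : traceIdeal R M => exists_smul_eq_of_mem_center hc a.2
  refine ⟨⟨⟨b, fun s t => Subtype.ext (eq_of_smul fun y => ?_)⟩,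
    fun r s => Subtype.ext (eq_of_smul fun y => ?_)⟩, fun f x => eq_of_smul fun y => ?_⟩
  · simp [add_smul, ← hb]
  · simp [mul_smul, ← hb]
  · refine Eq.trans ?_ (hb ⟨f x, apply_mem_traceIdeal f x⟩ y)
    have h := LinearMap.congr_fun (Subring.mem_center_iff.1 hc (f.smulRight y)) x
    simpa using h

end TraceIdeal

/-- (Lindo) Let `R` be a commutative Noetherian local ring and `M` a finitely generated
`R`-module which is faithful and reflexive.  Then `End_R(tr_R(M)) ≅ Z(End_R(M))` as rings. -/
theorem endTraceIdeal_ringEquiv_center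
    (R : Type*) [CommRing R] [IsNoetherianRing R] [IsLocalRing R]
    (M : Type*) [AddCommGroup M] [Module R M] [Module.Finite R M]
    (hfaithful : Module.annihilator R M = ⊥)
    (hreflexive : Function.Bijective (Module.Dual.eval R M)) :
    Nonempty ((Module.End R ↥(traceIdeal R M)) ≃+* ↥(Subring.center (Module.End R M))) := by
  choose φ hφ using exists_end_of_traceIdeal_end hreflexive
  have ext_end {g h : Module.End R M} := end_ext_of_eval_injective hreflexive.1 (g := g) (h := h)
  have φ_central (σ) : φ σ ∈ Subring.center (Module.End R M) :=
    Subring.mem_center_iff.2 fun g => ext_end fun f x =>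
      (hφ σ (f ∘ₗ g) x).trans (hφ σ f (g x)).symm
  let Φ : Module.End R (traceIdeal R M) →+* Subring.center (Module.End R M) :=
    { toFun := fun σ => ⟨φ σ, φ_central σ⟩
      map_one' := Subtype.ext (ext_end fun f x => hφ 1 f x)
      map_mul' := fun σ τ => Subtype.ext (ext_end fun f x => by
        have h : (⟨f (φ τ x), apply_mem_traceIdeal f _⟩ : traceIdeal R M) =
            τ ⟨f x, apply_mem_traceIdeal f x⟩ := Subtype.ext (hφ τ f x)
        change f (φ (σ * τ) x) = f (φ σ (φ τ x))
        rw [hφ, hφ, h, Module.End.mul_apply])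
      map_zero' := Subtype.ext (ext_end fun f x => by simp [hφ])
      map_add' := fun σ τ => Subtype.ext (ext_end fun f x => by simp [hφ]) }
  refine ⟨RingEquiv.ofBijective Φ ⟨fun σ τ h => traceIdeal_end_ext fun f x => ?_, fun c => ?_⟩⟩
  · have h' : φ σ = φ τ := congrArg Subtype.val h
    exact Subtype.ext (by rw [← hφ, ← hφ, h'])
  · obtain ⟨σ, hσ⟩ := exists_traceIdeal_end_of_mem_center hfaithful c.2
    exact ⟨σ, Subtype.ext (ext_end fun f x => (hφ σ f x).trans (hσ f x).symm)⟩
end
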